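/- Let 0 < q < 1 and ν ∈ ℂ with Re(ν) > -1. Then for every integer n, |J_ν(q^n; q²)| ≤ C · q^{nν} if n ≥ 0, and |J_ν(q^n; q²)| ≤ C · q^{n² - (ν+1)n} if n < 0, where C = (-q²; q²)_∞ (-q^{2ν+2}; q²)_∞ / (q²; q²)_∞ (here q^{nν} denotes q^{n·Re(ν)} etc., as a bound on the modulus). -/

import Mathlib

open scoped BigOperators
open Filter Topology

noncomputable section

/-- infinite q-Pochhammer symbol `(a;q)_∞` -/
def qPochInf (a q : ℂ) : ℂ := ∏' k : ℕ, (1 - a * q ^ k)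

/-- finite q-Pochhammer symbol `(a;q)_n` -/
def qPochFin (a q : ℂ) (n : ℕ) : ℂ := ∏ k ∈ Finset.range n, (1 - a * q ^ k)

/-- q-Pochhammer with complex exponent `(a;q)_μ = (a;q)_∞ / (a q^μ; q)_∞` -/
def qPochC (a q μ : ℂ) : ℂ := qPochInf a q / qPochInf (a * q ^ μ) q

/-- the third Jackson q-Bessel function `J_ν(z;q²)` -/
def qBessel (q : ℝ) (ν z : ℂ) : ℂ :=
  (qPochInf ((q:ℂ) ^ (2*ν+2)) ((q:ℂ)^(2:ℕ)) / qPochInf ((q:ℂ)^(2:ℕ)) ((q:ℂ)^(2:ℕ))) *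
    z ^ ν * ∑' n : ℕ, ((-1:ℂ)^n * (q:ℂ)^(n*(n+1)) * z^(2*n)) /
      (qPochFin ((q:ℂ)^(2:ℕ)) ((q:ℂ)^(2:ℕ)) n * qPochFin ((q:ℂ)^(2*ν+2)) ((q:ℂ)^(2:ℕ)) n)

/-- q-derivative `D_q f(z) = (f(z)-f(qz))/((1-q)z)` -/
def qDeriv (q : ℝ) (f : ℂ → ℂ) (z : ℂ) : ℂ := (f z - f ((q:ℂ)*z)) / ((1-(q:ℂ))*z)

/-- Jackson q-integral `∫₀^∞ f dq t` over the lattice `{q^k : k ∈ ℤ}` -/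
def jackson0Inf (q : ℝ) (f : ℂ → ℂ) : ℂ := (1-(q:ℂ)) * ∑' k : ℤ, (q:ℂ)^k * f ((q:ℂ)^k)

/-- Jackson q-integral `∫₀^x f dq t` -/
def jackson0X (q : ℝ) (x : ℂ) (f : ℂ → ℂ) : ℂ :=
  x*(1-(q:ℂ)) * ∑' n : ℕ, (q:ℂ)^n * f (x*(q:ℂ)^n)

/-- Jackson q-integral `∫_x^∞ f dq t = (1-q) Σ_{n≥1} x q^{-n} f(x q^{-n})` -/
def jacksonXInf (q : ℝ) (x : ℂ) (f : ℂ → ℂ) : ℂ :=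
  (1-(q:ℂ)) * ∑' n : ℕ, x*(q:ℂ)^(-(n:ℤ)-1) * f (x*(q:ℂ)^(-(n:ℤ)-1))

/-- the q-gamma function `Γ_q(x)` -/
def qGammaC (q : ℝ) (x : ℂ) : ℂ :=
  qPochInf (q:ℂ) (q:ℂ) * ((1-q : ℝ):ℂ)^(1-x) / qPochInf ((q:ℂ)^x) (q:ℂ)

/-- the coefficient `p^(n(n-1)/2) / (p;p)_n` of Euler's expansion of `(-x;p)_∞` -/
def eulerCoeff (p : ℝ) (n : ℕ) : ℝ :=
  p ^ (n.choose 2) / ∏ k ∈ Finset.range n, (1 - p * p ^ k)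

/-- Euler's series `∑ p^(n(n-1)/2) x^n / (p;p)_n` -/
def eulerSeries {𝕜 : Type*} [RCLike 𝕜] (p : ℝ) (x : 𝕜) : 𝕜 :=
  ∑' n : ℕ, (eulerCoeff p n : 𝕜) * x ^ n

section Euler

variable {𝕜 : Type*} [RCLike 𝕜] {p : ℝ}

lemma one_sub_mul_pow_pos (hp0 : 0 < p) (hp1 : p < 1) (k : ℕ) : 0 < 1 - p * p ^ k := by
  have := pow_lt_one₀ hp0.le hp1 (Nat.succ_ne_zero k)
  rw [pow_succ'] at this
  linarith

lemma eulerCoeff_pos (hp0 : 0 < p) (hp1 : p < 1) (n : ℕ) : 0 < eulerCoeff p n :=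
  div_pos (pow_pos hp0 _) (Finset.prod_pos fun k _ => one_sub_mul_pow_pos hp0 hp1 k)

lemma eulerCoeff_zero : eulerCoeff p 0 = 1 := by simp [eulerCoeff]

lemma eulerCoeff_succ_mul (hp0 : 0 < p) (hp1 : p < 1) (n : ℕ) :
    eulerCoeff p (n + 1) * (1 - p * p ^ n) = eulerCoeff p n * p ^ n := by
  have h := (one_sub_mul_pow_pos hp0 hp1 n).ne'
  have h' := (Finset.prod_pos (s := Finset.range n)
    fun k _ => one_sub_mul_pow_pos hp0 hp1 k).ne'
  have hc : (n + 1).choose 2 = n + n.choose 2 := by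
    rw [Nat.choose_succ_succ' n 1, Nat.choose_one_right]
  rw [eulerCoeff, eulerCoeff, Finset.prod_range_succ, hc, pow_add, div_mul_eq_mul_div,
    mul_div_mul_right _ _ h, div_mul_eq_mul_div, mul_comm]

lemma summable_eulerCoeff_mul_pow (hp0 : 0 < p) (hp1 : p < 1) {r : ℝ} (hr : 0 ≤ r) :
    Summable fun n => eulerCoeff p n * r ^ n := by
  have key : ∀ s : ℝ, 0 < s → Summable fun n => eulerCoeff p n * s ^ n := by
    intro s hs
    refine summable_of_ratio_test_tendsto_lt_one (l := 0) zero_lt_one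
      (Eventually.of_forall fun n => (mul_pos (eulerCoeff_pos hp0 hp1 n) (pow_pos hs n)).ne') ?_
    have hpn := tendsto_pow_atTop_nhds_zero_of_lt_one hp0.le hp1
    have hlim : Tendsto (fun n : ℕ => p ^ n * s / (1 - p * p ^ n)) atTop (𝓝 0) := by
      have := (hpn.mul_const s).div ((hpn.const_mul p).const_sub 1) (by simp)
      simpa [Pi.div_def] using this
    refine hlim.congr fun n => ?_
    have h1 := eulerCoeff_pos hp0 hp1 n
    have h2 := eulerCoeff_pos hp0 hp1 (n + 1)
    have h3 := one_sub_mul_pow_pos hp0 hp1 n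
    rw [Real.norm_of_nonneg (by positivity), Real.norm_of_nonneg (by positivity),
      div_eq_div_iff h3.ne' (by positivity)]
    linear_combination (-s * s ^ n) * eulerCoeff_succ_mul hp0 hp1 n
  refine (key (r + 1) (by linarith)).of_nonneg_of_le (fun n => ?_) fun n => ?_
  · exact mul_nonneg (eulerCoeff_pos hp0 hp1 n).le (pow_nonneg hr n)
  · exact mul_le_mul_of_nonneg_left (pow_le_pow_left₀ hr (by linarith) n)
      (eulerCoeff_pos hp0 hp1 n).le

lemma norm_eulerCoeff_mul_pow (hp0 : 0 < p) (hp1 : p < 1) (x : 𝕜) (n : ℕ) :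
    ‖(eulerCoeff p n : 𝕜) * x ^ n‖ = eulerCoeff p n * ‖x‖ ^ n := by
  rw [norm_mul, norm_pow, RCLike.norm_ofReal, abs_of_pos (eulerCoeff_pos hp0 hp1 n)]

lemma summable_norm_eulerSeries (hp0 : 0 < p) (hp1 : p < 1) (x : 𝕜) :
    Summable fun n => ‖(eulerCoeff p n : 𝕜) * x ^ n‖ := by
  simpa only [norm_eulerCoeff_mul_pow hp0 hp1] using
    summable_eulerCoeff_mul_pow hp0 hp1 (norm_nonneg x)

lemma eulerSeries_real (x : ℝ) : eulerSeries p x = ∑' n, eulerCoeff p n * x ^ n := rfl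

lemma norm_eulerSeries_le (hp0 : 0 < p) (hp1 : p < 1) {x : 𝕜} {r : ℝ} (hx : ‖x‖ ≤ r) :
    ‖eulerSeries p x‖ ≤ eulerSeries p r := by
  refine (norm_tsum_le_tsum_norm (summable_norm_eulerSeries hp0 hp1 x)).trans ?_
  refine (summable_norm_eulerSeries hp0 hp1 x).tsum_le_tsum (fun n => ?_)
    (summable_eulerCoeff_mul_pow hp0 hp1 ((norm_nonneg x).trans hx))
  rw [norm_eulerCoeff_mul_pow hp0 hp1]
  exact mul_le_mul_of_nonneg_left (pow_le_pow_left₀ (norm_nonneg x) hx n)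
    (eulerCoeff_pos hp0 hp1 n).le

lemma one_le_eulerSeries (hp0 : 0 < p) (hp1 : p < 1) {r : ℝ} (hr : 0 ≤ r) :
    1 ≤ eulerSeries p r := by
  have := (summable_eulerCoeff_mul_pow hp0 hp1 hr).le_tsum 0
    fun n _ => mul_nonneg (eulerCoeff_pos hp0 hp1 n).le (pow_nonneg hr n)
  rw [eulerSeries_real]
  simpa [eulerCoeff_zero] using this

lemma eulerSeries_eq_mul (hp0 : 0 < p) (hp1 : p < 1) (x : 𝕜) :
    eulerSeries p x = (1 + x) * eulerSeries p (x * p) := by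
  have hs := (summable_norm_eulerSeries hp0 hp1 x).of_norm
  have hs' := (summable_norm_eulerSeries hp0 hp1 (x * (p : 𝕜))).of_norm
  have h1 : ∑' n, (eulerCoeff p (n + 1) : 𝕜) * x ^ (n + 1) =
      ∑' n, ((eulerCoeff p (n + 1) : 𝕜) * (x * p) ^ (n + 1) +
        x * ((eulerCoeff p n : 𝕜) * (x * p) ^ n)) := by
    refine tsum_congr fun n => ?_
    have h := congrArg (fun t : ℝ => (t : 𝕜)) (eulerCoeff_succ_mul hp0 hp1 n)
    push_cast at h
    rw [mul_pow, mul_pow]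
    linear_combination (x ^ (n + 1)) * h
  rw [((summable_nat_add_iff 1).2 hs').tsum_add (hs'.mul_left x), tsum_mul_left] at h1
  have h2 := hs'.tsum_eq_zero_add
  rw [eulerSeries, hs.tsum_eq_zero_add, h1, add_mul, one_mul, eulerSeries]
  conv_rhs => rw [h2]
  simp only [pow_zero]
  rw [h2]
  ring

lemma eulerSeries_eq_prod_mul (hp0 : 0 < p) (hp1 : p < 1) (x : 𝕜) (n : ℕ) :
    eulerSeries p x =
      (∏ k ∈ Finset.range n, (1 + x * (p : 𝕜) ^ k)) * eulerSeries p (x * (p : 𝕜) ^ n) := by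
  induction n with
  | zero => simp
  | succ n ih =>
    rw [Finset.prod_range_succ, ih, eulerSeries_eq_mul hp0 hp1 (x * (p : 𝕜) ^ n), pow_succ]
    ring_nf

lemma tendsto_eulerSeries_mul_pow (hp0 : 0 < p) (hp1 : p < 1) (x : 𝕜) :
    Tendsto (fun n : ℕ => eulerSeries p (x * (p : 𝕜) ^ n)) atTop (𝓝 1) := by
  have hp : Tendsto (fun n : ℕ => x * (p : 𝕜) ^ n) atTop (𝓝 0) := by
    have : Tendsto (fun n : ℕ => (p : 𝕜) ^ n) atTop (𝓝 0) :=
      tendsto_pow_atTop_nhds_zero_of_norm_lt_one (by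
        rwa [RCLike.norm_ofReal, abs_of_pos hp0])
    simpa using this.const_mul x
  have h := tendsto_tsum_of_dominated_convergence
    (f := fun (n : ℕ) (k : ℕ) => (eulerCoeff p k : 𝕜) * (x * (p : 𝕜) ^ n) ^ k)
    (g := fun k => (eulerCoeff p k : 𝕜) * 0 ^ k) (𝓕 := atTop)
    (summable_norm_eulerSeries hp0 hp1 x)
    (fun k => (hp.pow k).const_mul _) (Eventually.of_forall fun n k => ?_)
  · have h0 : ∑' k, (eulerCoeff p k : 𝕜) * 0 ^ k = 1 := by
      rw [tsum_eq_single 0 fun k hk => by simp [hk]]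
      simp [eulerCoeff_zero]
    rwa [h0] at h
  · rw [norm_eulerCoeff_mul_pow hp0 hp1, norm_eulerCoeff_mul_pow hp0 hp1]
    refine mul_le_mul_of_nonneg_left (pow_le_pow_left₀ (norm_nonneg _) ?_ k)
      (eulerCoeff_pos hp0 hp1 k).le
    rw [norm_mul, norm_pow, RCLike.norm_ofReal, abs_of_pos hp0]
    exact mul_le_of_le_one_right (norm_nonneg _) (pow_le_one₀ hp0.le hp1.le)

lemma tendsto_prod_eulerSeries (hp0 : 0 < p) (hp1 : p < 1) (x : 𝕜) :
    Tendsto (fun n : ℕ => ∏ k ∈ Finset.range n, (1 + x * (p : 𝕜) ^ k)) atTop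
      (𝓝 (eulerSeries p x)) := by
  have h := tendsto_eulerSeries_mul_pow hp0 hp1 x
  have h' := (tendsto_const_nhds (x := eulerSeries p x)).div h one_ne_zero
  rw [div_one] at h'
  refine h'.congr' ?_
  filter_upwards [h.eventually_ne one_ne_zero] with n hn
  rw [Pi.div_apply, eulerSeries_eq_prod_mul hp0 hp1 x n, mul_div_cancel_right₀ _ hn]

/-- Euler's identity `(-x;p)_∞ = ∑ p^(n(n-1)/2) x^n / (p;p)_n`. -/
lemma tprod_one_add_mul_pow (hp0 : 0 < p) (hp1 : p < 1) (x : 𝕜) :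
    ∏' k : ℕ, (1 + x * (p : 𝕜) ^ k) = eulerSeries p x := by
  have hm : Multipliable fun k : ℕ => 1 + x * (p : 𝕜) ^ k := by
    refine multipliable_one_add_of_summable ?_
    simp only [norm_mul, norm_pow, RCLike.norm_ofReal, abs_of_pos hp0]
    exact (summable_geometric_of_lt_one hp0.le hp1).mul_left _
  exact tendsto_nhds_unique hm.hasProd.tendsto_prod_nat (tendsto_prod_eulerSeries hp0 hp1 x)

lemma norm_eulerSeries_neg_le_one (hp0 : 0 < p) (hp1 : p < 1) {y : ℝ} (hy0 : 0 ≤ y)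
    (hy1 : y ≤ 1) : ‖eulerSeries p (-(y : 𝕜))‖ ≤ 1 := by
  refine le_of_tendsto (tendsto_prod_eulerSeries hp0 hp1 (-(y : 𝕜))).norm
    (Eventually.of_forall fun n => ?_)
  rw [norm_prod]
  refine Finset.prod_le_one (fun _ _ => norm_nonneg _) fun k _ => ?_
  have h0 : 0 ≤ y * p ^ k := by positivity
  have h1 : y * p ^ k ≤ 1 := mul_le_one₀ hy1 (by positivity) (pow_le_one₀ hp0.le hp1.le)
  have : (1 + -(y : 𝕜) * (p : 𝕜) ^ k) = ((1 - y * p ^ k : ℝ) : 𝕜) := by push_cast; ring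
  rw [this, RCLike.norm_ofReal, abs_of_nonneg (by linarith)]
  linarith

lemma tsum_mul_eulerSeries_comm (hp0 : 0 < p) (hp1 : p < 1) (x y : 𝕜) :
    ∑' n, (eulerCoeff p n : 𝕜) * x ^ n * eulerSeries p (y * (p : 𝕜) ^ n) =
      ∑' n, (eulerCoeff p n : 𝕜) * y ^ n * eulerSeries p (x * (p : 𝕜) ^ n) := by
  have hs : Summable (Function.uncurry fun n k : ℕ => (eulerCoeff p n : 𝕜) * x ^ n *
      ((eulerCoeff p k : 𝕜) * (y * (p : 𝕜) ^ n) ^ k)) := by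
    refine Summable.of_norm_bounded ((summable_norm_eulerSeries hp0 hp1 x).mul_of_nonneg
      (summable_norm_eulerSeries hp0 hp1 y) (fun _ => norm_nonneg _) fun _ => norm_nonneg _) ?_
    rintro ⟨n, k⟩
    rw [Function.uncurry_apply_pair, norm_mul]
    refine mul_le_mul_of_nonneg_left ?_ (norm_nonneg _)
    rw [norm_eulerCoeff_mul_pow hp0 hp1, norm_eulerCoeff_mul_pow hp0 hp1]
    refine mul_le_mul_of_nonneg_left (pow_le_pow_left₀ (norm_nonneg _) ?_ k)
      (eulerCoeff_pos hp0 hp1 k).le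
    rw [norm_mul, norm_pow, RCLike.norm_ofReal, abs_of_pos hp0]
    exact mul_le_of_le_one_right (norm_nonneg _) (pow_le_one₀ hp0.le hp1.le)
  simp only [eulerSeries, ← tsum_mul_left]
  refine (Summable.tsum_comm hs).symm.trans ?_
  refine tsum_congr fun k => tsum_congr fun n => ?_
  simp only [mul_pow, ← pow_mul, mul_comm n k]
  ring

lemma norm_tsum_mul_eulerSeries_le (hp0 : 0 < p) (hp1 : p < 1) {x y : 𝕜} {r : ℝ}
    (hx : ‖x‖ ≤ r) :
    ‖∑' n, (eulerCoeff p n : 𝕜) * x ^ n * eulerSeries p (y * (p : 𝕜) ^ n)‖ ≤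
      eulerSeries p r * eulerSeries p ‖y‖ := by
  have hr := (norm_nonneg x).trans hx
  refine tsum_of_norm_bounded
    ((summable_eulerCoeff_mul_pow hp0 hp1 hr).hasSum.mul_right _) fun n => ?_
  rw [norm_mul, norm_eulerCoeff_mul_pow hp0 hp1]
  have hc := (eulerCoeff_pos hp0 hp1 n).le
  refine mul_le_mul (mul_le_mul_of_nonneg_left (pow_le_pow_left₀ (norm_nonneg x) hx n) hc)
    (norm_eulerSeries_le hp0 hp1 ?_) (norm_nonneg _) (by positivity)
  rw [norm_mul, norm_pow, RCLike.norm_ofReal, abs_of_pos hp0]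
  exact mul_le_of_le_one_right (norm_nonneg _) (pow_le_one₀ hp0.le hp1.le)

lemma eulerCoeff_add_mul_norm_le (hp0 : 0 < p) (hp1 : p < 1) (m j : ℕ) :
    eulerCoeff p (j + m) * ‖eulerSeries p (-((p * p ^ j : ℝ) : 𝕜))‖ ≤
      p ^ (m.choose 2) * eulerCoeff p j := by
  have hpos : ∀ k, 0 < 1 - p * p ^ k := one_sub_mul_pow_pos hp0 hp1
  have hprod : ∏ k ∈ Finset.range m, (1 + -((p * p ^ j : ℝ) : 𝕜) * (p : 𝕜) ^ k) =
      ((∏ k ∈ Finset.range m, (1 - p * p ^ (j + k)) : ℝ) : 𝕜) := by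
    push_cast
    exact Finset.prod_congr rfl fun k _ => by ring
  have harg : -((p * p ^ j : ℝ) : 𝕜) * (p : 𝕜) ^ m = -((p * p ^ (j + m) : ℝ) : 𝕜) := by
    push_cast; ring
  have hP : 0 < ∏ k ∈ Finset.range m, (1 - p * p ^ (j + k)) :=
    Finset.prod_pos fun k _ => hpos _
  have hQ : 0 < ∏ k ∈ Finset.range j, (1 - p * p ^ k) := Finset.prod_pos fun k _ => hpos _
  have hle : ‖eulerSeries p (-((p * p ^ j : ℝ) : 𝕜))‖ ≤
      ∏ k ∈ Finset.range m, (1 - p * p ^ (j + k)) := by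
    rw [eulerSeries_eq_prod_mul hp0 hp1 _ m, hprod, harg, norm_mul, RCLike.norm_ofReal,
      abs_of_pos hP]
    exact mul_le_of_le_one_right hP.le (norm_eulerSeries_neg_le_one hp0 hp1 (by positivity)
      (by linarith [hpos (j + m)]))
  refine (mul_le_mul_of_nonneg_left hle (eulerCoeff_pos hp0 hp1 _).le).trans ?_
  rw [eulerCoeff, eulerCoeff, Finset.prod_range_add, div_mul_eq_mul_div,
    mul_div_mul_right _ _ hP.ne', ← mul_div_assoc, ← pow_add]
  refine div_le_div_of_nonneg_right (pow_le_pow_of_le_one hp0.le hp1.le ?_) hQ.le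
  rw [add_comm (m.choose 2)]
  rw [Nat.add_choose_eq j m 2]
  have : (insert (2, 0) {(0, 2)} : Finset (ℕ × ℕ)) ⊆
      Finset.HasAntidiagonal.antidiagonal 2 := by decide
  simpa using Finset.sum_le_sum_of_subset (f := fun ij => j.choose ij.1 * m.choose ij.2) this

lemma norm_tsum_mul_eulerSeries_inv_le (hp0 : 0 < p) (hp1 : p < 1) (x : 𝕜) (m : ℕ) :
    ‖∑' n, (eulerCoeff p n : 𝕜) * x ^ n *
        eulerSeries p (-((p : 𝕜) * ((p : 𝕜) ^ m)⁻¹) * (p : 𝕜) ^ n)‖ ≤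
      ‖x‖ ^ m * p ^ (m.choose 2) * eulerSeries p ‖x‖ := by
  have hpk : (p : 𝕜) ≠ 0 := by exact_mod_cast hp0.ne'
  have hvanish : ∀ n < m, eulerSeries p (-((p : 𝕜) * ((p : 𝕜) ^ m)⁻¹) * (p : 𝕜) ^ n) = 0 := by
    intro n hn
    obtain ⟨d, rfl⟩ := Nat.exists_eq_add_of_lt hn
    rw [eulerSeries_eq_prod_mul hp0 hp1 _ (d + 1),
      Finset.prod_eq_zero (Finset.self_mem_range_succ d), zero_mul]
    field_simp
    ring
  have hshift : ∀ j, -((p : 𝕜) * ((p : 𝕜) ^ m)⁻¹) * (p : 𝕜) ^ (j + m) =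
      -((p * p ^ j : ℝ) : 𝕜) := by
    intro j
    push_cast
    field_simp
    ring
  set f : ℕ → 𝕜 := fun n => (eulerCoeff p n : 𝕜) * x ^ n *
    eulerSeries p (-((p : 𝕜) * ((p : 𝕜) ^ m)⁻¹) * (p : 𝕜) ^ n) with hf
  have hbound : ∀ j, ‖f (j + m)‖ ≤
      ‖x‖ ^ m * p ^ (m.choose 2) * (eulerCoeff p j * ‖x‖ ^ j) := by
    intro j
    rw [hf]
    simp only
    rw [hshift, norm_mul, norm_eulerCoeff_mul_pow hp0 hp1]
    have := mul_le_mul_of_nonneg_left (eulerCoeff_add_mul_norm_le (𝕜 := 𝕜) hp0 hp1 m j)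
      (pow_nonneg (norm_nonneg x) (j + m))
    refine (le_of_eq ?_).trans (this.trans (le_of_eq ?_)) <;> ring
  have hsum := (summable_eulerCoeff_mul_pow hp0 hp1 (norm_nonneg x)).hasSum.mul_left
    (‖x‖ ^ m * p ^ (m.choose 2))
  have hsf : Summable f :=
    (summable_nat_add_iff m).1 (Summable.of_norm_bounded hsum.summable hbound)
  rw [← hsf.sum_add_tsum_nat_add m, Finset.sum_eq_zero, zero_add]
  · exact tsum_of_norm_bounded hsum hbound
  · intro n hn
    rw [hf]
    simp only
    rw [hvanish n (Finset.mem_range.1 hn), mul_zero]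

end Euler

lemma qPochInf_eq_eulerSeries {p : ℝ} (hp0 : 0 < p) (hp1 : p < 1) (a : ℂ) :
    qPochInf a p = eulerSeries p (-a) := by
  rw [← tprod_one_add_mul_pow hp0 hp1]
  exact tprod_congr fun k => by simp; ring

lemma qPochFin_mul_eulerSeries {p : ℝ} (hp0 : 0 < p) (hp1 : p < 1) (a : ℂ) (n : ℕ) :
    qPochFin a p n * eulerSeries p (-a * (p : ℂ) ^ n) = eulerSeries p (-a) := by
  rw [eulerSeries_eq_prod_mul hp0 hp1 (-a) n]
  congr 1
  exact Finset.prod_congr rfl fun k _ => by simp; ring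

lemma qPochFin_ne_zero {p : ℝ} (hp0 : 0 < p) (hp1 : p < 1) {a : ℂ} (ha : ‖a‖ < 1) (n : ℕ) :
    qPochFin a p n ≠ 0 := by
  refine Finset.prod_ne_zero_iff.2 fun k _ h => ?_
  have h1 : ‖a * (p : ℂ) ^ k‖ = 1 := by rw [← sub_eq_zero.1 h, norm_one]
  rw [norm_mul, norm_pow, Complex.norm_real, Real.norm_of_nonneg hp0.le] at h1
  have := mul_le_of_le_one_right (norm_nonneg a) (pow_le_one₀ (n := k) hp0.le hp1.le)
  linarith

lemma ofReal_eulerCoeff (p : ℝ) (n : ℕ) :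
    ((eulerCoeff p n : ℝ) : ℂ) = (p : ℂ) ^ (n.choose 2) / qPochFin p p n := by
  simp [eulerCoeff, qPochFin]

/-- The third Jackson `q`-Bessel function through a series of infinite products, which makes sense
without dividing by `(q^(2ν+2);q²)_n`. -/
lemma qBessel_eq_tsum {q : ℝ} (hq0 : 0 < q) (hq1 : q < 1) {ν : ℂ} (hν : -1 < ν.re) (z : ℂ) :
    qBessel q ν z = z ^ ν / eulerSeries (q ^ 2) (-((q ^ 2 : ℝ) : ℂ)) *
      ∑' n, ((eulerCoeff (q ^ 2) n : ℝ) : ℂ) * (-(((q ^ 2 : ℝ) : ℂ) * z ^ 2)) ^ n *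
        eulerSeries (q ^ 2) (-(q : ℂ) ^ (2 * ν + 2) * ((q ^ 2 : ℝ) : ℂ) ^ n) := by
  have hp0 : 0 < q ^ 2 := by positivity
  have hp1 : q ^ 2 < 1 := pow_lt_one₀ hq0.le hq1 two_ne_zero
  have ha : ‖(q : ℂ) ^ (2 * ν + 2)‖ < 1 := by
    rw [Complex.norm_cpow_eq_rpow_re_of_pos hq0]
    refine Real.rpow_lt_one hq0.le hq1 ?_
    simp
    linarith
  rw [qBessel, ← Complex.ofReal_pow, qPochInf_eq_eulerSeries hp0 hp1,
    qPochInf_eq_eulerSeries hp0 hp1, div_mul_eq_mul_div, div_mul_eq_mul_div, div_mul_eq_mul_div,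
    mul_comm (eulerSeries _ _) (z ^ ν), mul_assoc (z ^ ν), ← tsum_mul_left]
  congr 3
  ext n
  rw [← qPochFin_mul_eulerSeries hp0 hp1 _ n, ofReal_eulerCoeff]
  have h1 := qPochFin_ne_zero hp0 hp1 ha n
  have h2 : qPochFin ((q ^ 2 : ℝ) : ℂ) ((q ^ 2 : ℝ) : ℂ) n ≠ 0 :=
    qPochFin_ne_zero hp0 hp1 (by rwa [Complex.norm_real, Real.norm_of_nonneg hp0.le]) n
  have h3 : n * (n + 1) = 2 * n.choose 2 + 2 * n := by
    have h4 : (n + 1).choose 2 = n + n.choose 2 := by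
      rw [Nat.choose_succ_succ' n 1, Nat.choose_one_right]
    have h5 := Nat.choose_two_right (n + 1)
    have h6 := Nat.div_mul_cancel (Nat.even_mul_pred_self (n + 1)).two_dvd
    rw [← h5, h4, Nat.add_sub_cancel] at h6
    linarith
  rw [h3, pow_add, pow_mul, pow_mul, neg_pow (_ * z ^ 2),
    mul_pow _ (z ^ 2), pow_mul z]
  generalize qPochFin ((q : ℂ) ^ (2 * ν + 2)) _ n = A at h1 ⊢
  generalize qPochFin ((q ^ 2 : ℝ) : ℂ) _ n = B at h2 ⊢
  push_cast
  field_simp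

theorem stmt_2 (q : ℝ) (hq0 : 0 < q) (hq1 : q < 1) (ν : ℂ) (hν : -1 < ν.re) :
    ∀ n : ℤ,
      (0 ≤ n → ‖qBessel q ν ((q:ℂ)^n)‖ ≤
        ((∏' k : ℕ, (1 + q^2 * (q^2)^k)) * (∏' k : ℕ, (1 + q^(2*ν.re+2) * (q^2)^k)) /
          (∏' k : ℕ, (1 - q^2 * (q^2)^k))) * q ^ ((n:ℝ) * ν.re)) ∧
      (n < 0 → ‖qBessel q ν ((q:ℂ)^n)‖ ≤
        ((∏' k : ℕ, (1 + q^2 * (q^2)^k)) * (∏' k : ℕ, (1 + q^(2*ν.re+2) * (q^2)^k)) /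
          (∏' k : ℕ, (1 - q^2 * (q^2)^k))) * q ^ ((n:ℝ)^2 - (ν.re+1) * (n:ℝ))) := by
  have hp0 : 0 < q ^ 2 := by positivity
  have hp1 : q ^ 2 < 1 := pow_lt_one₀ hq0.le hq1 two_ne_zero
  have ha : ‖-(q : ℂ) ^ (2 * ν + 2)‖ = q ^ (2 * ν.re + 2) := by
    rw [norm_neg, Complex.norm_cpow_eq_rpow_re_of_pos hq0]
    simp
  have hprod : ∀ r : ℝ, ∏' k : ℕ, (1 + r * (q ^ 2) ^ k) = eulerSeries (q ^ 2) r :=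
    fun r => tprod_one_add_mul_pow hp0 hp1 r
  have hden : ∏' k : ℕ, (1 - q ^ 2 * (q ^ 2) ^ k) = eulerSeries (q ^ 2) (-(q ^ 2)) := by
    rw [← hprod]
    exact tprod_congr fun k => by ring
  have hdenC : ‖eulerSeries (q ^ 2) (-((q ^ 2 : ℝ) : ℂ))‖ = eulerSeries (q ^ 2) (-(q ^ 2)) := by
    have hcast : eulerSeries (q ^ 2) (-((q ^ 2 : ℝ) : ℂ)) =
        ((eulerSeries (q ^ 2) (-(q ^ 2)) : ℝ) : ℂ) := by
      rw [eulerSeries_real, Complex.ofReal_tsum, eulerSeries]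
      exact tsum_congr fun n => by push_cast; rfl
    rw [hcast, Complex.norm_real, Real.norm_of_nonneg]
    refine ge_of_tendsto' (tendsto_prod_eulerSeries hp0 hp1 (-(q ^ 2))) fun n =>
      Finset.prod_nonneg fun k _ => ?_
    have := one_sub_mul_pow_pos hp0 hp1 k
    simp only [RCLike.ofReal_real_eq_id, id]
    linarith
  have hden0 : 0 ≤ eulerSeries (q ^ 2) (-(q ^ 2)) := hdenC ▸ norm_nonneg _
  have hz : ∀ n : ℤ, ‖((q : ℂ) ^ n) ^ ν‖ = q ^ ((n : ℝ) * ν.re) := by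
    intro n
    rw [← Complex.ofReal_zpow, Complex.norm_cpow_eq_rpow_re_of_pos (zpow_pos hq0 n),
      Real.rpow_mul hq0.le, Real.rpow_intCast]
  intro n
  rw [hprod, hprod, hden, qBessel_eq_tsum hq0 hq1 hν, norm_mul, norm_div, hz, hdenC]
  constructor
  · intro hn
    obtain ⟨m, rfl⟩ := Int.eq_ofNat_of_zero_le hn
    have hx : ‖-(((q ^ 2 : ℝ) : ℂ) * ((q : ℂ) ^ (m : ℤ)) ^ 2)‖ ≤ q ^ 2 := by
      rw [norm_neg, norm_mul, Complex.norm_real, Real.norm_of_nonneg hp0.le, norm_pow, norm_zpow,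
        Complex.norm_real, Real.norm_of_nonneg hq0.le, zpow_natCast]
      exact mul_le_of_le_one_right hp0.le (pow_le_one₀ (by positivity)
        (pow_le_one₀ hq0.le hq1.le))
    have h := norm_tsum_mul_eulerSeries_le hp0 hp1 (y := -(q : ℂ) ^ (2 * ν + 2)) hx
    rw [ha] at h
    calc _ ≤ q ^ (((m : ℤ) : ℝ) * ν.re) / eulerSeries (q ^ 2) (-(q ^ 2)) *
          (eulerSeries (q ^ 2) (q ^ 2) * eulerSeries (q ^ 2) (q ^ (2 * ν.re + 2))) :=
        mul_le_mul_of_nonneg_left h (by positivity)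
      _ = _ := by ring
  · intro hn
    obtain ⟨m, hm⟩ := Int.eq_ofNat_of_zero_le (neg_nonneg.2 hn.le)
    obtain rfl : n = -(m : ℤ) := by omega
    have hx : -(((q ^ 2 : ℝ) : ℂ) * ((q : ℂ) ^ (-(m : ℤ))) ^ 2) =
        -(((q ^ 2 : ℝ) : ℂ) * (((q ^ 2 : ℝ) : ℂ) ^ m)⁻¹) := by
      rw [zpow_neg, zpow_natCast, inv_pow, ← pow_mul, mul_comm m 2, pow_mul]
      push_cast
      rfl
    rw [hx]
    have h := norm_tsum_mul_eulerSeries_inv_le hp0 hp1 (-(q : ℂ) ^ (2 * ν + 2)) m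
    have hcomm := tsum_mul_eulerSeries_comm hp0 hp1 (-(q : ℂ) ^ (2 * ν + 2))
      (-(((q ^ 2 : ℝ) : ℂ) * (((q ^ 2 : ℝ) : ℂ) ^ m)⁻¹))
    have h' := hcomm ▸ h
    rw [ha] at h'
    have hpow : q ^ (((-(m : ℤ) : ℤ) : ℝ) * ν.re) *
        ((q ^ (2 * ν.re + 2)) ^ m * (q ^ 2) ^ (m.choose 2)) =
        q ^ (((-(m : ℤ) : ℤ) : ℝ) ^ 2 - (ν.re + 1) * ((-(m : ℤ) : ℤ) : ℝ)) := by
      rw [← Real.rpow_mul_natCast hq0.le, ← pow_mul, ← Real.rpow_natCast q (2 * _),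
        ← Real.rpow_add hq0, ← Real.rpow_add hq0]
      congr 1
      push_cast
      rw [Nat.cast_choose_two]
      ring
    have hone := one_le_eulerSeries hp0 hp1 hp0.le
    have hnn : 0 ≤ eulerSeries (q ^ 2) (q ^ (2 * ν.re + 2)) :=
      zero_le_one.trans (one_le_eulerSeries hp0 hp1 (by positivity))
    rw [← hpow]
    calc _ ≤ q ^ (((-(m : ℤ) : ℤ) : ℝ) * ν.re) / eulerSeries (q ^ 2) (-(q ^ 2)) *
          ((q ^ (2 * ν.re + 2)) ^ m * (q ^ 2) ^ (m.choose 2) *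
            eulerSeries (q ^ 2) (q ^ (2 * ν.re + 2))) :=
        mul_le_mul_of_nonneg_left h' (by positivity)
      _ = 1 * (q ^ (((-(m : ℤ) : ℤ) : ℝ) * ν.re) / eulerSeries (q ^ 2) (-(q ^ 2)) *
          ((q ^ (2 * ν.re + 2)) ^ m * (q ^ 2) ^ (m.choose 2) *
            eulerSeries (q ^ 2) (q ^ (2 * ν.re + 2)))) := (one_mul _).symm
      _ ≤ eulerSeries (q ^ 2) (q ^ 2) * (q ^ (((-(m : ℤ) : ℤ) : ℝ) * ν.re) /
          eulerSeries (q ^ 2) (-(q ^ 2)) * ((q ^ (2 * ν.re + 2)) ^ m * (q ^ 2) ^ (m.choose 2) *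
            eulerSeries (q ^ 2) (q ^ (2 * ν.re + 2)))) :=
        mul_le_mul_of_nonneg_right hone (by positivity)
      _ = _ := by ring
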